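/- Let ρ_ABC be a density matrix on H_A ⊗ H_B ⊗ H_C satisfying I(A:C|B)_ρ = 0. Let P_AB, P_BC, and P_ABC be the orthogonal projections onto the supports of ρ_AB, ρ_BC, and ρ_ABC, respectively. Then P_ABC = (P_AB ⊗ 1_C)(1_A ⊗ P_BC). -/

import Mathlib

open Matrix Kronecker BigOperators
open scoped ComplexOrder

/-- A density matrix: a positive semidefinite matrix of trace one. -/
def IsDensityMatrix {n : Type*} [Fintype n] (ρ : Matrix n n ℂ) : Prop :=
  ρ.PosSemidef ∧ ρ.trace = 1

/-- `P` is the orthogonal projection onto the support of `ρ`, i.e. `P` is a Hermitian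
idempotent whose kernel is exactly the kernel of `ρ`. -/
def IsSupportProj {n : Type*} [Fintype n] (ρ P : Matrix n n ℂ) : Prop :=
  P.IsHermitian ∧ P * P = P ∧ ∀ v : n → ℂ, ρ.mulVec v = 0 ↔ P.mulVec v = 0

/-- The von Neumann entropy `S(ρ) = -Tr(ρ log ρ)`, computed via the eigenvalues of a
Hermitian matrix (with the convention `0 log 0 = 0`). -/
noncomputable def vNEntropy {n : Type*} [Fintype n] [DecidableEq n]
    (ρ : Matrix n n ℂ) : ℝ :=
  if h : ρ.IsHermitian then -∑ i, h.eigenvalues i * Real.log (h.eigenvalues i) else 0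

/-- Reduced density matrix on `A × B` (partial trace over `C`). -/
noncomputable def margAB {A B C : Type*} [Fintype C]
    (ρ : Matrix (A × B × C) (A × B × C) ℂ) : Matrix (A × B) (A × B) ℂ :=
  Matrix.of fun p q => ∑ c : C, ρ (p.1, p.2, c) (q.1, q.2, c)

/-- Reduced density matrix on `B × C` (partial trace over `A`). -/
noncomputable def margBC {A B C : Type*} [Fintype A]
    (ρ : Matrix (A × B × C) (A × B × C) ℂ) : Matrix (B × C) (B × C) ℂ :=
  Matrix.of fun p q => ∑ a : A, ρ (a, p) (a, q)

/-- Reduced density matrix on `B` (partial trace over `A` and `C`). -/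
noncomputable def margB {A B C : Type*} [Fintype A] [Fintype C]
    (ρ : Matrix (A × B × C) (A × B × C) ℂ) : Matrix B B ℂ :=
  Matrix.of fun b b' => ∑ a : A, ∑ c : C, ρ (a, b, c) (a, b', c)

/-- Conditional mutual information `I(A:C|B) = S(AB) + S(BC) - S(B) - S(ABC)`. -/
noncomputable def CMI {A B C : Type*} [Fintype A] [DecidableEq A]
    [Fintype B] [DecidableEq B] [Fintype C] [DecidableEq C]
    (ρ : Matrix (A × B × C) (A × B × C) ℂ) : ℝ :=
  vNEntropy (margAB ρ) + vNEntropy (margBC ρ) - vNEntropy (margB ρ) - vNEntropy ρ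

section Scalar

theorem coeff_eq_zero_of_sum_inv_add_eq_zero (S : Finset ℝ) (hS : ∀ y ∈ S, 0 ≤ y) (d : ℝ → ℂ)
    (h : ∀ t : ℝ, 0 < t → ∑ y ∈ S, d y * ((y : ℂ) + t)⁻¹ = 0) : ∀ y ∈ S, d y = 0 := by
  set P : Polynomial ℂ :=
    ∑ y ∈ S, Polynomial.C (d y) * ∏ l ∈ S.erase y, (Polynomial.X + Polynomial.C (l : ℂ)) with hP
  have hroot : ∀ t : ℝ, 0 < t → P.eval (t : ℂ) = 0 := by
    intro t ht
    have hne : ∀ y ∈ S, (y : ℂ) + t ≠ 0 := fun y hy => by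
      have := hS y hy
      exact_mod_cast (by positivity : y + t ≠ 0)
    have : P.eval (t : ℂ) = (∏ l ∈ S, ((l : ℂ) + t)) * ∑ y ∈ S, d y * ((y : ℂ) + t)⁻¹ := by
      rw [hP, Polynomial.eval_finsetSum, Finset.mul_sum]
      refine Finset.sum_congr rfl fun y hy => ?_
      rw [← Finset.mul_prod_erase S _ hy, Polynomial.eval_mul, Polynomial.eval_prod]
      have := hne y hy
      simp only [Polynomial.eval_C, Polynomial.eval_add, Polynomial.eval_X]
      field_simp
      simp only [add_comm]
    rw [this, h t ht, mul_zero]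
  have hP0 : P = 0 := by
    refine Polynomial.eq_zero_of_infinite_isRoot P
      (Set.Infinite.mono (s := (fun t : ℝ => (t : ℂ)) '' Set.Ioi 0) ?_ ?_)
    · rintro _ ⟨t, ht, rfl⟩
      exact hroot t ht
    · exact (Set.Ioi_infinite (0 : ℝ)).image Complex.ofReal_injective.injOn
  intro y hy
  have h1 : P.eval (-(y : ℂ)) = 0 := by simp [hP0]
  rw [hP, Polynomial.eval_finsetSum, Finset.sum_eq_single_of_mem y hy] at h1
  · rw [Polynomial.eval_mul, Polynomial.eval_C, mul_eq_zero, Polynomial.eval_prod,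
      Finset.prod_eq_zero_iff] at h1
    refine h1.resolve_right ?_
    rintro ⟨l, hl, h2⟩
    simp only [Polynomial.eval_add, Polynomial.eval_X, Polynomial.eval_C] at h2
    refine (Finset.mem_erase.1 hl).1 ?_
    have : (l : ℂ) = y := by linear_combination h2
    exact_mod_cast this
  · intro z hz hzy
    rw [Polynomial.eval_mul, Polynomial.eval_prod,
      Finset.prod_eq_zero (Finset.mem_erase.2 ⟨Ne.symm hzy, hy⟩) (by simp), mul_zero]

/-- The Cauchy kernels `t ↦ (x + t)⁻¹` determine a finite combination of point masses. -/
theorem sum_mul_apply_eq_zero_of_sum_inv_add_eq_zero {K : Type*} [Fintype K] (x : K → ℝ)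
    (hx : ∀ k, 0 ≤ x k) (c : K → ℂ)
    (h : ∀ t : ℝ, 0 < t → ∑ k, c k * ((x k : ℂ) + t)⁻¹ = 0) (f : ℝ → ℂ) :
    ∑ k, c k * f (x k) = 0 := by
  classical
  have key : ∀ g : ℝ → ℂ, ∑ k, c k * g (x k) =
      ∑ y ∈ Finset.univ.image x, (∑ k with x k = y, c k) * g y := by
    intro g
    rw [← Finset.sum_fiberwise_of_maps_to (s := Finset.univ) (t := Finset.univ.image x) (g := x)
      (fun k _ => Finset.mem_image_of_mem x (Finset.mem_univ k))]
    refine Finset.sum_congr rfl fun y _ => ?_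
    rw [Finset.sum_mul]
    refine Finset.sum_congr rfl fun k hk => ?_
    rw [(Finset.mem_filter.1 hk).2]
  rw [key f]
  refine Finset.sum_eq_zero fun y hy => ?_
  rw [coeff_eq_zero_of_sum_inv_add_eq_zero (Finset.univ.image x) (by simpa using hx)
    (fun y => ∑ k with x k = y, c k) (fun t ht => ?_) y hy, zero_mul]
  rw [← key (fun y => ((y : ℂ) + t)⁻¹)]
  exact h t ht

theorem hasDerivAt_sum_mul_log {K : Type*} [Fintype K] {p r s : K → ℝ}
    (hp : ∀ k, p k ≠ 0 → 0 < s k ∧ 0 < r k) {t : ℝ} (ht : 0 ≤ t) :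
    HasDerivAt (fun t => ∑ k, p k * Real.log (s k + t * r k))
      (∑ k, p k * (r k / (s k + t * r k))) t := by
  refine HasDerivAt.fun_sum fun k _ => ?_
  by_cases hk : p k = 0
  · simpa [hk] using hasDerivAt_const t (0 : ℝ)
  obtain ⟨hs, hr⟩ := hp k hk
  refine HasDerivAt.const_mul _ (HasDerivAt.log ?_ (by positivity))
  simpa using ((hasDerivAt_id t).mul_const (r k)).const_add (s k)

theorem tendsto_sum_mul_log_sub {K : Type*} [Fintype K] {p r s : K → ℝ}
    (hp : ∀ k, p k ≠ 0 → 0 < s k ∧ 0 < r k) :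
    Filter.Tendsto (fun t => ∑ k, p k * Real.log (s k + t * r k) - (∑ k, p k) * Real.log t)
      Filter.atTop (nhds (∑ k, p k * Real.log (r k))) := by
  simp only [Finset.sum_mul, ← Finset.sum_sub_distrib]
  refine tendsto_finsetSum _ fun k _ => ?_
  by_cases hk : p k = 0
  · simp [hk]
  obtain ⟨hs, hr⟩ := hp k hk
  have h1 : Filter.Tendsto (fun t : ℝ => s k * t⁻¹ + r k) Filter.atTop (nhds (r k)) := by
    simpa using (tendsto_inv_atTop_zero.const_mul (s k)).add_const (r k)
  refine ((h1.log hr.ne').const_mul (p k)).congr' ?_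
  filter_upwards [Filter.eventually_gt_atTop 0] with t ht
  rw [← mul_sub, ← Real.log_div (by positivity) ht.ne']
  congr 2
  field_simp

/-- If the logarithmic potentials of two point-mass families agree, then one-sided domination of
their resolvents forces equality. -/
theorem sum_resolvent_eq_of_le {K K' : Type*} [Fintype K] [Fintype K'] {p r s : K → ℝ}
    {p' r' s' : K' → ℝ} (hp : ∀ k, p k ≠ 0 → 0 < s k ∧ 0 < r k)
    (hp' : ∀ k, p' k ≠ 0 → 0 < s' k ∧ 0 < r' k) (hsum : ∑ k, p k = ∑ k, p' k)
    (hlog : ∑ k, p k * Real.log (r k) - ∑ k, p k * Real.log (s k) =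
      ∑ k, p' k * Real.log (r' k) - ∑ k, p' k * Real.log (s' k))
    (hle : ∀ t : ℝ, 0 < t → ∑ k, p' k * (r' k / (s' k + t * r' k)) ≤
      ∑ k, p k * (r k / (s k + t * r k))) {t : ℝ} (ht : 0 < t) :
    ∑ k, p k * (r k / (s k + t * r k)) = ∑ k, p' k * (r' k / (s' k + t * r' k)) := by
  set G : ℝ → ℝ := fun t => ∑ k, p k * Real.log (s k + t * r k) -
    ∑ k, p' k * Real.log (s' k + t * r' k) with hG
  have hder : ∀ t : ℝ, 0 ≤ t → HasDerivAt G (∑ k, p k * (r k / (s k + t * r k)) -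
      ∑ k, p' k * (r' k / (s' k + t * r' k))) t := fun t ht =>
    (hasDerivAt_sum_mul_log hp ht).sub (hasDerivAt_sum_mul_log hp' ht)
  have hmono : MonotoneOn G (Set.Ici 0) := by
    refine monotoneOn_of_deriv_nonneg (convex_Ici 0)
      (fun t ht => (hder t ht).continuousAt.continuousWithinAt) ?_ ?_
    · intro t ht
      rw [interior_Ici] at ht
      exact (hder t (le_of_lt ht)).differentiableAt.differentiableWithinAt
    · intro t ht
      rw [interior_Ici] at ht
      rw [(hder t (le_of_lt ht)).deriv]
      exact sub_nonneg.2 (hle t ht)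
  have hlim : Filter.Tendsto G Filter.atTop (nhds (G 0)) := by
    have h0 : G 0 = ∑ k, p k * Real.log (r k) - ∑ k, p' k * Real.log (r' k) := by
      simp only [hG, zero_mul, add_zero]
      linarith
    rw [h0]
    refine ((tendsto_sum_mul_log_sub hp).sub (tendsto_sum_mul_log_sub hp')).congr fun t => ?_
    simp only [hG, hsum]
    ring
  have hconst : ∀ t, 0 ≤ t → G t = G 0 := by
    intro t ht
    refine le_antisymm ?_ (hmono Set.self_mem_Ici ht ht)
    refine ge_of_tendsto hlim ?_
    filter_upwards [Filter.eventually_ge_atTop t] with u hu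
    exact hmono ht (ht.trans hu) hu
  have h1 : HasDerivAt G 0 t := by
    refine (hasDerivAt_const t (G 0)).congr_of_eventuallyEq ?_
    filter_upwards [lt_mem_nhds ht] with u hu
    exact hconst u hu.le
  exact sub_eq_zero.1 ((hder t ht.le).unique h1)

end Scalar

section SpectralCalculus

variable {n : Type*} [Fintype n] [DecidableEq n]

/-- The functional calculus `U f(s) Uᴴ` of a matrix given by a diagonalization. -/
noncomputable def specFun (U : Matrix n n ℂ) (s : n → ℝ) (f : ℝ → ℂ) : Matrix n n ℂ :=
  U * diagonal (fun i => f (s i)) * Uᴴ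

/-- The double functional calculus `∑ k(sᵢ, rⱼ) Sᵢ Rⱼ` for two diagonalizations `U, s` and `V, r`
with spectral projections `Sᵢ` and `Rⱼ`. -/
noncomputable def doubleSpecFun (U : Matrix n n ℂ) (s : n → ℝ) (V : Matrix n n ℂ) (r : n → ℝ)
    (k : ℝ → ℝ → ℂ) : Matrix n n ℂ :=
  U * of (fun i j => k (s i) (r j) * (Uᴴ * V) i j) * Vᴴ

variable {U V : Matrix n n ℂ} {s r : n → ℝ}

theorem specFun_congr {f g : ℝ → ℂ} (h : ∀ i, f (s i) = g (s i)) :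
    specFun U s f = specFun U s g := by
  simp only [specFun, h]

set_option linter.unusedSectionVars false in
theorem doubleSpecFun_congr {k l : ℝ → ℝ → ℂ} (h : ∀ i j, k (s i) (r j) = l (s i) (r j)) :
    doubleSpecFun U s V r k = doubleSpecFun U s V r l := by
  simp only [doubleSpecFun, h]

theorem specFun_conjTranspose (f : ℝ → ℂ) :
    (specFun U s f)ᴴ = specFun U s (fun x => star (f x)) := by
  simp only [specFun, conjTranspose_mul, conjTranspose_conjTranspose, diagonal_conjTranspose,
    Matrix.mul_assoc]
  rfl

theorem specFun_one (hU : Uᴴ * U = 1) : specFun U s (fun _ => 1) = 1 := by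
  simp [specFun, mul_eq_one_comm.1 hU]

theorem specFun_mul_specFun (hU : Uᴴ * U = 1) (f g : ℝ → ℂ) :
    specFun U s f * specFun U s g = specFun U s (fun x => f x * g x) := by
  simp only [specFun]
  rw [← diagonal_mul_diagonal]
  calc _ = U * diagonal (fun i => f (s i)) * (Uᴴ * U) * diagonal (fun i => g (s i)) * Uᴴ := by
        simp only [Matrix.mul_assoc]
    _ = _ := by rw [hU]; simp only [Matrix.mul_assoc, Matrix.one_mul]

theorem specFun_mul_doubleSpecFun (hU : Uᴴ * U = 1) (f : ℝ → ℂ) (k : ℝ → ℝ → ℂ) :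
    specFun U s f * doubleSpecFun U s V r k = doubleSpecFun U s V r (fun x y => f x * k x y) := by
  simp only [specFun, doubleSpecFun]
  calc _ = U * diagonal (fun i => f (s i)) * (Uᴴ * U) *
          of (fun i j => k (s i) (r j) * (Uᴴ * V) i j) * Vᴴ := by simp only [Matrix.mul_assoc]
    _ = U * (diagonal (fun i => f (s i)) * of (fun i j => k (s i) (r j) * (Uᴴ * V) i j)) * Vᴴ := by
        rw [hU]; simp only [Matrix.mul_assoc, Matrix.one_mul]
    _ = _ := by
        congr 2
        ext i j
        simp only [diagonal_mul, of_apply, mul_assoc]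

theorem doubleSpecFun_mul_specFun (hV : Vᴴ * V = 1) (g : ℝ → ℂ) (k : ℝ → ℝ → ℂ) :
    doubleSpecFun U s V r k * specFun V r g = doubleSpecFun U s V r (fun x y => k x y * g y) := by
  simp only [specFun, doubleSpecFun]
  calc _ = U * of (fun i j => k (s i) (r j) * (Uᴴ * V) i j) * (Vᴴ * V) *
          diagonal (fun i => g (r i)) * Vᴴ := by simp only [Matrix.mul_assoc]
    _ = U * (of (fun i j => k (s i) (r j) * (Uᴴ * V) i j) * diagonal (fun i => g (r i))) * Vᴴ := by
        rw [hV]; simp only [Matrix.mul_assoc, Matrix.one_mul]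
    _ = _ := by
        congr 2
        ext i j
        simp only [mul_diagonal, of_apply]
        ring

theorem doubleSpecFun_one (hU : Uᴴ * U = 1) (hV : Vᴴ * V = 1) :
    doubleSpecFun U s V r (fun _ _ => 1) = 1 := by
  simp only [doubleSpecFun, one_mul]
  calc _ = U * (Uᴴ * V) * Vᴴ := rfl
    _ = (U * Uᴴ) * (V * Vᴴ) := by simp only [Matrix.mul_assoc]
    _ = 1 := by rw [mul_eq_one_comm.1 hU, mul_eq_one_comm.1 hV, one_mul]

set_option linter.unusedSectionVars false in
theorem doubleSpecFun_add (k l : ℝ → ℝ → ℂ) :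
    doubleSpecFun U s V r k + doubleSpecFun U s V r l =
      doubleSpecFun U s V r (fun x y => k x y + l x y) := by
  simp only [doubleSpecFun, ← Matrix.add_mul, ← Matrix.mul_add]
  congr 2
  ext i j
  simp [add_mul]

set_option linter.unusedSectionVars false in
theorem doubleSpecFun_smul (c : ℂ) (k : ℝ → ℝ → ℂ) :
    c • doubleSpecFun U s V r k = doubleSpecFun U s V r (fun x y => c * k x y) := by
  rw [doubleSpecFun, doubleSpecFun, ← Matrix.smul_mul, ← Matrix.mul_smul]
  congr 2
  ext i j
  simp [mul_assoc]

theorem doubleSpecFun_mul (hU : Uᴴ * U = 1) (hV : Vᴴ * V = 1) (f g : ℝ → ℂ) :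
    doubleSpecFun U s V r (fun x y => f x * g y) = specFun U s f * specFun V r g := by
  calc _ = specFun U s f * doubleSpecFun U s V r (fun _ _ => 1) * specFun V r g := by
        rw [specFun_mul_doubleSpecFun hU, doubleSpecFun_mul_specFun hV]
        simp only [mul_one]
    _ = _ := by rw [doubleSpecFun_one hU hV, Matrix.mul_one]

theorem doubleSpecFun_eq_sum (k : ℝ → ℝ → ℂ) :
    doubleSpecFun U s V r k = ∑ p : n × n, k (s p.1) (r p.2) •
      (U * single p.1 p.2 ((Uᴴ * V) p.1 p.2) * Vᴴ) := by
  have h : of (fun i j => k (s i) (r j) * (Uᴴ * V) i j) =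
      ∑ p : n × n, k (s p.1) (r p.2) • single p.1 p.2 ((Uᴴ * V) p.1 p.2) := by
    rw [Fintype.sum_prod_type, matrix_eq_sum_single (of _)]
    simp only [smul_single, of_apply, smul_eq_mul]
  rw [doubleSpecFun, h, Matrix.mul_sum, Matrix.sum_mul]
  simp only [Matrix.mul_smul, Matrix.smul_mul]

theorem trace_specFun (hU : Uᴴ * U = 1) (f : ℝ → ℂ) : (specFun U s f).trace = ∑ i, f (s i) := by
  rw [specFun, trace_mul_comm, ← Matrix.mul_assoc, hU, Matrix.one_mul, trace_diagonal]

theorem trace_specFun_mul_doubleSpecFun (hV : Vᴴ * V = 1) (g : ℝ → ℂ) (k : ℝ → ℝ → ℂ) :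
    (specFun V r g * doubleSpecFun U s V r k).trace =
      ∑ p : n × n, (Complex.normSq ((Uᴴ * V) p.1 p.2) : ℂ) * (k (s p.1) (r p.2) * g (r p.2)) := by
  rw [trace_mul_comm, doubleSpecFun_mul_specFun hV, doubleSpecFun, Matrix.mul_assoc,
    trace_mul_comm, Matrix.mul_assoc]
  simp only [trace, diag, Fintype.sum_prod_type]
  refine Finset.sum_congr rfl fun i _ => ?_
  rw [Matrix.mul_apply]
  refine Finset.sum_congr rfl fun j _ => ?_
  have : (Vᴴ * U) j i = star ((Uᴴ * V) i j) := by
    rw [← conjTranspose_apply, conjTranspose_mul, conjTranspose_conjTranspose]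
  rw [this, of_apply, Complex.normSq_eq_conj_mul_self, Complex.star_def]
  ring

theorem trace_specFun_mul_specFun (hU : Uᴴ * U = 1) (hV : Vᴴ * V = 1) (f g : ℝ → ℂ) :
    (specFun V r g * specFun U s f).trace =
      ∑ p : n × n, (Complex.normSq ((Uᴴ * V) p.1 p.2) : ℂ) * (f (s p.1) * g (r p.2)) := by
  have h := trace_specFun_mul_doubleSpecFun (U := U) (s := s) (r := r) hV g (fun x _ => f x)
  have h1 := doubleSpecFun_mul (s := s) (r := r) hU hV f (fun _ => 1)
  simp only [mul_one, specFun_one hV] at h1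
  rw [← h, h1]

end SpectralCalculus

section Markov

variable {m n : Type*} [Fintype m] [DecidableEq m] [Fintype n] [DecidableEq n]

set_option linter.unusedSectionVars false in
theorem mul_eq_zero_of_trace_mul_conjTranspose_eq_zero {D R : Matrix n n ℂ}
    (h : (D * (R * Rᴴ) * Dᴴ).trace = 0) : D * R = 0 := by
  rw [← trace_mul_conjTranspose_self_eq_zero_iff, conjTranspose_mul]
  simpa only [Matrix.mul_assoc] using h

/-- The gap between the two resolvent quadratic forms, in terms of solutions of the Sylvester
equations `σ X + t X ρ = ρ`. -/
theorem trace_sylvester_sub (e : Matrix m m ℂ →⋆ₐ[ℂ] Matrix n n ℂ) {ρ σ X : Matrix n n ℂ}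
    {ρ' σ' X' : Matrix m m ℂ} (hρ : ∀ Y, (ρ * e Y).trace = (ρ' * Y).trace)
    (hσ : ∀ Y, (σ * e Y).trace = (σ' * Y).trace) (hρH : ρᴴ = ρ) (hσH : σᴴ = σ) (t : ℝ)
    (hX : σ * X + (t : ℂ) • (X * ρ) = ρ) (hX' : σ' * X' + (t : ℂ) • (X' * ρ') = ρ') :
    (ρ * Xᴴ).trace - (ρ' * X').trace = ((e X' - X)ᴴ * σ * (e X' - X)).trace +
      t * ((e X' - X) * ρ * (e X' - X)ᴴ).trace := by
  have hXH : Xᴴ * σ + (t : ℂ) • (ρ * Xᴴ) = ρ := by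
    have := congrArg conjTranspose hX
    simpa [conjTranspose_add, conjTranspose_mul, conjTranspose_smul, hρH, hσH] using this
  have hstar : (e X')ᴴ = e X'ᴴ := (map_star e X').symm
  have h1 : ((e X')ᴴ * σ * e X').trace + t * (e X' * ρ * (e X')ᴴ).trace = (ρ' * X'ᴴ).trace := by
    have ha : ((e X')ᴴ * σ * e X').trace = (σ' * X' * X'ᴴ).trace := by
      rw [hstar, Matrix.mul_assoc, trace_mul_comm, Matrix.mul_assoc, ← map_mul, hσ,
        ← Matrix.mul_assoc]
    have hb : (e X' * ρ * (e X')ᴴ).trace = (X' * ρ' * X'ᴴ).trace := by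
      rw [hstar, Matrix.mul_assoc, trace_mul_comm, Matrix.mul_assoc, ← map_mul, hρ,
        ← Matrix.mul_assoc, trace_mul_comm, ← Matrix.mul_assoc]
    rw [ha, hb]
    conv_rhs => rw [← hX', Matrix.add_mul, Matrix.smul_mul, trace_add, trace_smul, smul_eq_mul]
  have h2 : ((e X')ᴴ * σ * X).trace + t * (X * ρ * (e X')ᴴ).trace = (ρ' * X'ᴴ).trace := by
    rw [← hρ, ← hstar]
    conv_rhs => rw [← hX, Matrix.add_mul, Matrix.smul_mul, trace_add, trace_smul, smul_eq_mul]
    congr 1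
    rw [Matrix.mul_assoc, trace_mul_comm]
  have h3 : (Xᴴ * σ * e X').trace + t * (e X' * ρ * Xᴴ).trace = (ρ' * X').trace := by
    rw [← hρ]
    conv_rhs => rw [← hXH, Matrix.add_mul, Matrix.smul_mul, trace_add, trace_smul, smul_eq_mul]
    congr 2
    rw [Matrix.mul_assoc, trace_mul_comm]
  have h4 : (Xᴴ * σ * X).trace + t * (X * ρ * Xᴴ).trace = (ρ * Xᴴ).trace := by
    conv_rhs => rw [← hX, Matrix.add_mul, Matrix.smul_mul, trace_add, trace_smul, smul_eq_mul]
    congr 1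
    rw [Matrix.mul_assoc, trace_mul_comm]
  simp only [conjTranspose_sub, Matrix.sub_mul, Matrix.mul_sub, trace_sub]
  linear_combination h2 + h3 - h1 - h4

/-- The indicator of the nonzero reals. -/
noncomputable def nzInd (x : ℝ) : ℂ := if x = 0 then 0 else 1

/-- The complex power `x ^ z`, with value `0` at `x = 0` for every exponent. -/
noncomputable def suppPow (z : ℂ) (x : ℝ) : ℂ := if x = 0 then 0 else Complex.exp (z * Real.log x)

theorem suppPow_zero : suppPow 0 = nzInd := by
  ext x
  simp [suppPow, nzInd]

theorem suppPow_mul (z w : ℂ) (x : ℝ) : suppPow z x * suppPow w x = suppPow (z + w) x := by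
  by_cases hx : x = 0
  · simp [suppPow, hx]
  · simp [suppPow, hx, add_mul, Complex.exp_add]

theorem star_suppPow (z : ℂ) (x : ℝ) : star (suppPow z x) = suppPow (star z) x := by
  by_cases hx : x = 0
  · simp [suppPow, hx]
  · simp [suppPow, hx, ← Complex.exp_conj, Complex.conj_ofReal]

theorem suppPow_one {x : ℝ} (hx : 0 ≤ x) : suppPow 1 x = x := by
  rcases hx.eq_or_lt with rfl | hx
  · simp [suppPow]
  · rw [suppPow, if_neg hx.ne', one_mul, ← Complex.ofReal_exp, Real.exp_log hx]

theorem suppPow_div {x y : ℝ} (hx : 0 ≤ x) (hy : 0 ≤ y) (z : ℂ) :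
    nzInd y * suppPow z (x / y) = suppPow z x * suppPow (-z) y := by
  rcases hx.eq_or_lt with rfl | hx
  · simp [suppPow]
  rcases hy.eq_or_lt with rfl | hy
  · simp [suppPow]
  simp only [suppPow, nzInd, hx.ne', hy.ne', div_eq_zero_iff, if_false, or_self, one_mul,
    Real.log_div hx.ne' hy.ne', ← Complex.exp_add]
  congr 1
  push_cast
  ring

theorem differentiable_suppPow (x : ℝ) : Differentiable ℂ (fun z => suppPow z x) := by
  unfold suppPow
  by_cases hx : x = 0
  · simp [hx]
  · simp only [hx, if_false]
    fun_prop

/-- The kernel of the solution of the Sylvester equation `σ X + t X ρ = ρ`. -/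
noncomputable def sylvKer (t x y : ℝ) : ℂ := y / (x + t * y)

theorem sylvKer_eq {t x y : ℝ} : sylvKer t x y = nzInd y * (((x / y : ℝ) : ℂ) + t)⁻¹ := by
  by_cases hy : y = 0
  · simp [sylvKer, nzInd, hy]
  · have : (y : ℂ) ≠ 0 := by exact_mod_cast hy
    simp only [sylvKer, nzInd, hy, if_false, one_mul]
    push_cast
    rw [div_add' _ _ _ this, inv_div]

theorem sylvester_doubleSpecFun {U V : Matrix n n ℂ} {s r : n → ℝ} (hU : Uᴴ * U = 1)
    (hV : Vᴴ * V = 1) (hs : ∀ i, 0 ≤ s i) (hr : ∀ i, 0 ≤ r i) {t : ℝ} (ht : 0 < t) :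
    specFun U s (fun x => x) * doubleSpecFun U s V r (sylvKer t) +
      (t : ℂ) • (doubleSpecFun U s V r (sylvKer t) * specFun V r (fun x => x)) =
      specFun V r (fun x => x) := by
  rw [specFun_mul_doubleSpecFun hU, doubleSpecFun_mul_specFun hV, doubleSpecFun_smul,
    doubleSpecFun_add]
  rw [doubleSpecFun_congr (l := fun _ y => (1 : ℂ) * y), doubleSpecFun_mul hU hV
    (fun _ => 1) (fun y => (y : ℂ)), specFun_one hU, Matrix.one_mul]
  intro i j
  by_cases hj : r j = 0
  · simp [sylvKer, hj]
  · have h0 : 0 < r j := lt_of_le_of_ne (hr j) (Ne.symm hj)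
    have h1 : ((s i : ℂ) + t * r j) ≠ 0 := by
      have := hs i
      exact_mod_cast (by positivity : s i + t * r j ≠ 0)
    simp only [sylvKer]
    rw [one_mul]
    refine Eq.trans ?_ (mul_div_cancel₀ (r j : ℂ) h1)
    ring

theorem overlap_eq_zero_of_support {U V : Matrix n n ℂ} {s r : n → ℝ} (hU : Uᴴ * U = 1)
    (hV : Vᴴ * V = 1) (hsup : specFun U s nzInd * specFun V r (fun x => x) =
      specFun V r (fun x => x)) (i j : n) (hj : r j ≠ 0) (hi : s i = 0) : (Uᴴ * V) i j = 0 := by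
  have h : diagonal (fun i => nzInd (s i)) * (Uᴴ * V) * diagonal (fun j => (r j : ℂ)) =
      (Uᴴ * V) * diagonal (fun j => (r j : ℂ)) := by
    calc _ = (Uᴴ * U) * diagonal (fun i => nzInd (s i)) * (Uᴴ * V) *
          diagonal (fun j => (r j : ℂ)) * (Vᴴ * V) := by
            rw [hU, hV, Matrix.one_mul, Matrix.mul_one]
      _ = Uᴴ * (specFun U s nzInd * specFun V r (fun x => x)) * V := by
            simp only [specFun, Matrix.mul_assoc]
      _ = Uᴴ * V * diagonal (fun j => (r j : ℂ)) * (Vᴴ * V) := by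
            rw [hsup]
            simp only [specFun, Matrix.mul_assoc]
      _ = _ := by rw [hV, Matrix.mul_one]
  have h1 := congrFun (congrFun h i) j
  rw [mul_diagonal, mul_diagonal, diagonal_mul, nzInd, if_pos hi, zero_mul, zero_mul] at h1
  have : (r j : ℂ) ≠ 0 := by exact_mod_cast hj
  exact (mul_eq_zero.1 h1.symm).resolve_right this

theorem weight_pos_of_support {U V : Matrix n n ℂ} {s r : n → ℝ} (hU : Uᴴ * U = 1)
    (hV : Vᴴ * V = 1) (hs : ∀ i, 0 ≤ s i) (hr : ∀ i, 0 ≤ r i)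
    (hsup : specFun U s nzInd * specFun V r (fun x => x) = specFun V r (fun x => x))
    (p : n × n) (hp : Complex.normSq ((Uᴴ * V) p.1 p.2) * r p.2 ≠ 0) :
    0 < s p.1 ∧ 0 < r p.2 := by
  obtain ⟨h1, h2⟩ := mul_ne_zero_iff.1 hp
  refine ⟨lt_of_le_of_ne (hs _) fun h => h1 ?_, lt_of_le_of_ne (hr _) (Ne.symm h2)⟩
  rw [overlap_eq_zero_of_support hU hV hsup _ _ h2 h.symm, map_zero]

theorem specFun_id_mul_inv {V : Matrix n n ℂ} {r : n → ℝ} (hV : Vᴴ * V = 1) :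
    specFun V r (fun x => x) * specFun V r (fun x => (x : ℂ)⁻¹) = specFun V r nzInd := by
  rw [specFun_mul_specFun hV]
  refine specFun_congr fun i => ?_
  by_cases hi : r i = 0
  · simp [nzInd, hi]
  · simp [nzInd, hi]

theorem specFun_id_conjTranspose {V : Matrix n n ℂ} {r : n → ℝ} :
    (specFun V r (fun x => x))ᴴ = specFun V r (fun x => x) := by
  rw [specFun_conjTranspose]
  exact specFun_congr fun i => Complex.conj_ofReal _

theorem trace_mul_specFun_mul_conjTranspose_nonneg {V : Matrix n n ℂ} {r : n → ℝ}
    (hr : ∀ i, 0 ≤ r i) (D : Matrix n n ℂ) :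
    0 ≤ (D * specFun V r (fun x => x) * Dᴴ).trace := by
  have h : (specFun V r (fun x => x)).PosSemidef :=
    (PosSemidef.diagonal (d := fun i => (r i : ℂ))
      (fun i => Complex.zero_le_real.2 (hr i))).mul_mul_conjTranspose_same V
  exact (h.mul_mul_conjTranspose_same D).trace_nonneg

theorem specFun_sqrt_mul {V : Matrix n n ℂ} {r : n → ℝ} (hV : Vᴴ * V = 1) (hr : ∀ i, 0 ≤ r i) :
    specFun V r (suppPow (1 / 2)) * (specFun V r (suppPow (1 / 2)))ᴴ =
      specFun V r (fun x => x) := by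
  rw [specFun_conjTranspose, specFun_mul_specFun hV]
  refine specFun_congr fun i => ?_
  rw [star_suppPow, suppPow_mul]
  have : (1 / 2 : ℂ) + star (1 / 2 : ℂ) = 1 := by
    simp
    norm_num
  rw [this, suppPow_one (hr i)]

theorem mul_specFun_eq_zero {V : Matrix n n ℂ} {r : n → ℝ} (hV : Vᴴ * V = 1) (hr : ∀ i, 0 ≤ r i)
    {D : Matrix n n ℂ} (h : (D * specFun V r (fun x => x) * Dᴴ).trace = 0) :
    D * specFun V r nzInd = 0 := by
  rw [← specFun_sqrt_mul hV hr] at h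
  have h1 := mul_eq_zero_of_trace_mul_conjTranspose_eq_zero h
  rw [← specFun_id_mul_inv hV, ← specFun_sqrt_mul hV hr, ← Matrix.mul_assoc, ← Matrix.mul_assoc,
    h1, Matrix.zero_mul, Matrix.zero_mul]

theorem doubleSpecFun_sylvKer_mul {U V : Matrix n n ℂ} {s r : n → ℝ} (hV : Vᴴ * V = 1) (t : ℝ) :
    doubleSpecFun U s V r (sylvKer t) * specFun V r nzInd =
      doubleSpecFun U s V r (sylvKer t) := by
  rw [doubleSpecFun_mul_specFun hV]
  refine doubleSpecFun_congr fun i j => ?_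
  by_cases hj : r j = 0
  · simp [sylvKer, hj]
  · simp [nzInd, hj]

theorem trace_specFun_mul_sylvKer {U V : Matrix n n ℂ} {s r : n → ℝ} (hV : Vᴴ * V = 1) (t : ℝ) :
    (specFun V r (fun x => x) * doubleSpecFun U s V r (sylvKer t)).trace =
      ((∑ p : n × n, Complex.normSq ((Uᴴ * V) p.1 p.2) * r p.2 *
        (r p.2 / (s p.1 + t * r p.2)) : ℝ) : ℂ) := by
  rw [trace_specFun_mul_doubleSpecFun hV]
  push_cast
  refine Finset.sum_congr rfl fun p _ => ?_
  simp only [sylvKer]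
  ring

theorem sum_normSq_mul {U V : Matrix n n ℂ} (s : n → ℝ) {r : n → ℝ} (hU : Uᴴ * U = 1)
    (hV : Vᴴ * V = 1) (f g : ℝ → ℝ) :
    ((∑ p : n × n, Complex.normSq ((Uᴴ * V) p.1 p.2) * (f (s p.1) * g (r p.2)) : ℝ) : ℂ) =
      (specFun V r (fun x => g x) * specFun U s (fun x => f x)).trace := by
  rw [trace_specFun_mul_specFun hU hV]
  push_cast
  rfl

theorem sum_normSq_mul_right {U V : Matrix n n ℂ} {r : n → ℝ} (hU : Uᴴ * U = 1)
    (hV : Vᴴ * V = 1) (g : ℝ → ℝ) :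
    ∑ p : n × n, Complex.normSq ((Uᴴ * V) p.1 p.2) * g (r p.2) = ∑ j, g (r j) := by
  have h := sum_normSq_mul (r := r) (fun _ => 0) hU hV (fun _ => 1) g
  simp only [one_mul, Complex.ofReal_one, specFun_one hU, Matrix.mul_one, trace_specFun hV] at h
  exact_mod_cast h

/-- Saturation of the monotonicity of relative entropy under restriction to the subalgebra
`e (Matrix m m ℂ)` intertwines the Sylvester solutions. -/
theorem doubleSpecFun_sylvKer_eq (e : Matrix m m ℂ →⋆ₐ[ℂ] Matrix n n ℂ)
    {U V : Matrix n n ℂ} {s r : n → ℝ} {U' V' : Matrix m m ℂ} {s' r' : m → ℝ}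
    (hU : Uᴴ * U = 1) (hV : Vᴴ * V = 1) (hU' : U'ᴴ * U' = 1) (hV' : V'ᴴ * V' = 1)
    (hs : ∀ i, 0 ≤ s i) (hr : ∀ i, 0 ≤ r i) (hs' : ∀ i, 0 ≤ s' i) (hr' : ∀ i, 0 ≤ r' i)
    (hρ : ∀ Y, (specFun V r (fun x => x) * e Y).trace = (specFun V' r' (fun x => x) * Y).trace)
    (hσ : ∀ Y, (specFun U s (fun x => x) * e Y).trace = (specFun U' s' (fun x => x) * Y).trace)
    (hsup : specFun U s nzInd * specFun V r (fun x => x) = specFun V r (fun x => x))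
    (hsup' : specFun U' s' nzInd * specFun V' r' (fun x => x) = specFun V' r' (fun x => x))
    (hent : ∑ j, r j * Real.log (r j) -
        (specFun V r (fun x => x) * specFun U s (fun x => Real.log x)).trace =
      ∑ j, r' j * Real.log (r' j) -
        (specFun V' r' (fun x => x) * specFun U' s' (fun x => Real.log x)).trace)
    {t : ℝ} (ht : 0 < t) :
    doubleSpecFun U s V r (sylvKer t) =
      e (doubleSpecFun U' s' V' r' (sylvKer t)) * specFun V r nzInd := by
  set ρ := specFun V r (fun x => x) with hρdef
  set σ := specFun U s (fun x => x) with hσdef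
  set ρ' := specFun V' r' (fun x => x) with hρdef'
  set σ' := specFun U' s' (fun x => x) with hσdef'
  have gap : ∀ t : ℝ, 0 < t → _ := fun t ht =>
    trace_sylvester_sub e hρ hσ specFun_id_conjTranspose specFun_id_conjTranspose t
      (sylvester_doubleSpecFun hU hV hs hr ht) (sylvester_doubleSpecFun hU' hV' hs' hr' ht)
  have htr : ∀ t : ℝ, (ρ * (doubleSpecFun U s V r (sylvKer t))ᴴ).trace =
      ((∑ p : n × n, Complex.normSq ((Uᴴ * V) p.1 p.2) * r p.2 *
        (r p.2 / (s p.1 + t * r p.2)) : ℝ) : ℂ) := by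
    intro t
    have h := congrArg star (trace_specFun_mul_sylvKer (U := U) (s := s) (r := r) hV t)
    rw [← trace_conjTranspose, conjTranspose_mul, specFun_id_conjTranspose, trace_mul_comm] at h
    rw [hρdef, h]
    exact Complex.conj_ofReal _
  have hpos : ∀ t : ℝ, ∀ D : Matrix n n ℂ, 0 < t →
      0 ≤ (Dᴴ * σ * D).trace ∧ 0 ≤ t * (D * ρ * Dᴴ).trace := by
    intro t D ht
    refine ⟨?_, mul_nonneg (by exact_mod_cast ht.le)
      (trace_mul_specFun_mul_conjTranspose_nonneg hr D)⟩
    simpa using trace_mul_specFun_mul_conjTranspose_nonneg (V := U) hs Dᴴ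
  have hsum : ∑ j, r j = ∑ j, r' j := by
    have h := hρ 1
    rw [map_one, Matrix.mul_one, Matrix.mul_one, hρdef, hρdef', trace_specFun hV,
      trace_specFun hV'] at h
    exact_mod_cast h
  have heq := sum_resolvent_eq_of_le
    (p := fun p : n × n => Complex.normSq ((Uᴴ * V) p.1 p.2) * r p.2)
    (r := fun p => r p.2) (s := fun p => s p.1)
    (p' := fun p : m × m => Complex.normSq ((U'ᴴ * V') p.1 p.2) * r' p.2)
    (r' := fun p => r' p.2) (s' := fun p => s' p.1)
    (weight_pos_of_support hU hV hs hr hsup) (weight_pos_of_support hU' hV' hs' hr' hsup')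
    (by
      rw [sum_normSq_mul_right hU hV (fun x => x), sum_normSq_mul_right hU' hV' (fun x => x), hsum])
    (by
      have h1 := sum_normSq_mul_right (r := r) hU hV (fun x => x * Real.log x)
      have h2 := sum_normSq_mul_right (r := r') hU' hV' (fun x => x * Real.log x)
      rw [← sum_normSq_mul s hU hV Real.log (fun x => x), ← h1,
        ← sum_normSq_mul s' hU' hV' Real.log (fun x => x), ← h2] at hent
      rw [← Complex.ofReal_sub, ← Complex.ofReal_sub] at hent
      have h3 := Complex.ofReal_injective hent
      simp only [mul_assoc]
      rw [← sub_eq_zero] at h3 ⊢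
      rw [← h3]
      simp only [mul_comm (Real.log (s _)), mul_comm (Real.log (s' _))])
    (fun t ht => by
      have h := gap t ht
      rw [htr, trace_specFun_mul_sylvKer hV', ← Complex.ofReal_sub] at h
      have h1 : (0 : ℂ) ≤ _ := (add_nonneg (hpos t _ ht).1 (hpos t _ ht).2).trans_eq h.symm
      rw [Complex.zero_le_real] at h1
      exact sub_nonneg.1 h1) ht
  have h := gap t ht
  rw [htr, trace_specFun_mul_sylvKer hV', heq, sub_self] at h
  have h1 := ((add_eq_zero_iff_of_nonneg (hpos t _ ht).1 (hpos t _ ht).2).1 h.symm).2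
  have h2 := mul_specFun_eq_zero hV hr
    ((mul_eq_zero.1 h1).resolve_left (by exact_mod_cast ht.ne'))
  rw [Matrix.sub_mul, doubleSpecFun_sylvKer_mul hV, sub_eq_zero] at h2
  exact h2.symm

end Markov

section Conclusion

variable {m n : Type*} [Fintype m] [DecidableEq m] [Fintype n] [DecidableEq n]

/-- Since the Cauchy kernels separate points, intertwining of the Sylvester solutions passes to
complex powers. -/
theorem suppPow_intertwine (e : Matrix m m ℂ →⋆ₐ[ℂ] Matrix n n ℂ)
    {U V : Matrix n n ℂ} {s r : n → ℝ} {U' V' : Matrix m m ℂ} {s' r' : m → ℝ}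
    (hU : Uᴴ * U = 1) (hV : Vᴴ * V = 1) (hU' : U'ᴴ * U' = 1) (hV' : V'ᴴ * V' = 1)
    (hs : ∀ i, 0 ≤ s i) (hr : ∀ i, 0 ≤ r i) (hs' : ∀ i, 0 ≤ s' i) (hr' : ∀ i, 0 ≤ r' i)
    {Q : Matrix n n ℂ}
    (h : ∀ t : ℝ, 0 < t → doubleSpecFun U s V r (sylvKer t) =
      e (doubleSpecFun U' s' V' r' (sylvKer t)) * Q) (z : ℂ) :
    specFun U s (suppPow z) * specFun V r (suppPow (-z)) =
      e (specFun U' s' (suppPow z) * specFun V' r' (suppPow (-z))) * Q := by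
  have hk : ∀ f : ℝ → ℂ, ∀ a b, (doubleSpecFun U s V r (fun x y => nzInd y * f (x / y)) -
      e (doubleSpecFun U' s' V' r' (fun x y => nzInd y * f (x / y))) * Q) a b =
      ∑ k : (n × n) ⊕ (m × m),
        Sum.elim (fun p => nzInd (r p.2) * (U * single p.1 p.2 ((Uᴴ * V) p.1 p.2) * Vᴴ) a b)
          (fun p => -(nzInd (r' p.2) *
            (e (U' * single p.1 p.2 ((U'ᴴ * V') p.1 p.2) * V'ᴴ) * Q) a b)) k *
        f (Sum.elim (fun p => s p.1 / r p.2) (fun p => s' p.1 / r' p.2) k) := by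
    intro f a b
    rw [doubleSpecFun_eq_sum, doubleSpecFun_eq_sum, map_sum, Matrix.sum_mul, Matrix.sub_apply,
      Matrix.sum_apply, Matrix.sum_apply, Fintype.sum_sum_type, sub_eq_add_neg,
      ← Finset.sum_neg_distrib]
    simp only [Sum.elim_inl, Sum.elim_inr, map_smul, Matrix.smul_mul, Matrix.smul_apply,
      smul_eq_mul]
    refine congrArg₂ _ (Finset.sum_congr rfl fun p _ => ?_) (Finset.sum_congr rfl fun p _ => ?_)
    · ring
    · ring
  have hz : doubleSpecFun U s V r (fun x y => nzInd y * suppPow z (x / y)) =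
      e (doubleSpecFun U' s' V' r' (fun x y => nzInd y * suppPow z (x / y))) * Q := by
    rw [← sub_eq_zero]
    ext a b
    rw [hk, Matrix.zero_apply]
    refine sum_mul_apply_eq_zero_of_sum_inv_add_eq_zero _ ?_ _ (fun t ht => ?_) _
    · rintro (p | p)
      · exact div_nonneg (hs _) (hr _)
      · exact div_nonneg (hs' _) (hr' _)
    · rw [← hk (fun x => ((x : ℂ) + t)⁻¹) a b]
      have h1 := h t ht
      have h2 : sylvKer t = fun x y => nzInd y * (((x / y : ℝ) : ℂ) + t)⁻¹ := by
        ext x y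
        exact sylvKer_eq
      rw [h2] at h1
      rw [h1, sub_self, Matrix.zero_apply]
  rw [← doubleSpecFun_mul hU hV, ← doubleSpecFun_mul hU' hV',
    doubleSpecFun_congr (l := fun x y => nzInd y * suppPow z (x / y))
      fun i j => (suppPow_div (hs i) (hr j) z).symm, hz]
  congr 2
  exact doubleSpecFun_congr fun i j => suppPow_div (hs' i) (hr' j) z

theorem specFun_suppPow_mul {U : Matrix n n ℂ} {s : n → ℝ} (hU : Uᴴ * U = 1) (z w : ℂ) :
    specFun U s (suppPow z) * specFun U s (suppPow w) = specFun U s (suppPow (z + w)) := by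
  rw [specFun_mul_specFun hU]
  exact specFun_congr fun i => suppPow_mul z w _

theorem specFun_suppPow_one {U : Matrix n n ℂ} {s : n → ℝ} (hs : ∀ i, 0 ≤ s i) :
    specFun U s (suppPow 1) = specFun U s (fun x => x) :=
  specFun_congr fun i => suppPow_one (hs i)

theorem specFun_suppPow_conjTranspose {U : Matrix n n ℂ} {s : n → ℝ} (z : ℂ) :
    (specFun U s (suppPow z))ᴴ = specFun U s (suppPow (star z)) := by
  rw [specFun_conjTranspose]
  exact specFun_congr fun i => star_suppPow z _

theorem specFun_nzInd_conjTranspose {U : Matrix n n ℂ} {s : n → ℝ} :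
    (specFun U s nzInd)ᴴ = specFun U s nzInd := by
  rw [← suppPow_zero, specFun_suppPow_conjTranspose, star_zero]

theorem suppPow_zero_mul_of_support {U V : Matrix n n ℂ} {s r : n → ℝ}
    (hV : Vᴴ * V = 1) (hr : ∀ i, 0 ≤ r i)
    (hsup : specFun U s nzInd * specFun V r (fun x => x) = specFun V r (fun x => x)) (w : ℂ) :
    specFun U s (suppPow 0) * specFun V r (suppPow w) = specFun V r (suppPow w) := by
  have h : specFun V r (suppPow w) = specFun V r (fun x => x) * specFun V r (suppPow (w - 1)) := by
    rw [← specFun_suppPow_one hr, specFun_suppPow_mul hV]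
    congr 2
    ring
  rw [h, ← Matrix.mul_assoc, suppPow_zero, hsup]

/-- On the critical line, the intertwining relation upgrades to a factorization of the power of
`ρ`: the two sides have the same Hilbert-Schmidt norm. -/
theorem suppPow_factor (e : Matrix m m ℂ →⋆ₐ[ℂ] Matrix n n ℂ)
    {U V : Matrix n n ℂ} {s r : n → ℝ} {U' V' : Matrix m m ℂ} {s' r' : m → ℝ}
    (hU : Uᴴ * U = 1) (hV : Vᴴ * V = 1) (hU' : U'ᴴ * U' = 1) (hV' : V'ᴴ * V' = 1)
    (hs : ∀ i, 0 ≤ s i) (hr : ∀ i, 0 ≤ r i) (hs' : ∀ i, 0 ≤ s' i) (hr' : ∀ i, 0 ≤ r' i)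
    (hρ : ∀ Y, (specFun V r (fun x => x) * e Y).trace = (specFun V' r' (fun x => x) * Y).trace)
    (hσ : ∀ Y, (specFun U s (fun x => x) * e Y).trace = (specFun U' s' (fun x => x) * Y).trace)
    (hsup : specFun U s nzInd * specFun V r (fun x => x) = specFun V r (fun x => x))
    (hsup' : specFun U' s' nzInd * specFun V' r' (fun x => x) = specFun V' r' (fun x => x))
    (h : ∀ z, specFun U s (suppPow z) * specFun V r (suppPow (-z)) =
      e (specFun U' s' (suppPow z) * specFun V' r' (suppPow (-z))) * specFun V r nzInd)
    {w : ℂ} (hw : w + star w = 1) :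
    specFun U s (suppPow w) * e (specFun U' s' (suppPow (-w)) * specFun V' r' (suppPow w)) =
      specFun V r (suppPow w) := by
  set Y := specFun U' s' (suppPow (-w)) * specFun V' r' (suppPow w) with hY
  set Z := specFun U s (suppPow w) * e Y with hZ
  set P := specFun V r nzInd with hP
  have hP0 : P = specFun V r (suppPow 0) := by rw [suppPow_zero]
  have hPH : Pᴴ = P := by rw [hP0, specFun_suppPow_conjTranspose, star_zero]
  have hPP : P * P = P := by rw [hP0, specFun_suppPow_mul hV, add_zero]
  have hZP : Z * P = specFun V r (suppPow w) := by
    have h1 := congrArg (specFun U s (suppPow w) * ·) (h (-w))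
    simp only [neg_neg] at h1
    rw [← Matrix.mul_assoc, specFun_suppPow_mul hU, add_neg_cancel,
      suppPow_zero_mul_of_support hV hr hsup, ← Matrix.mul_assoc] at h1
    exact h1.symm
  have hw' : star w + w = 1 := by rw [add_comm, hw]
  have hZZ : (Z * Zᴴ).trace = (specFun V' r' (fun x => x)).trace := by
    have hstar : (e Y)ᴴ = e Yᴴ := (map_star e Y).symm
    calc (Z * Zᴴ).trace = ((specFun U s (suppPow w))ᴴ * specFun U s (suppPow w) *
          (e Y * (e Y)ᴴ)).trace := by
          rw [hZ, conjTranspose_mul, ← Matrix.mul_assoc, trace_mul_comm]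
          simp only [Matrix.mul_assoc]
      _ = (specFun U' s' (fun x => x) * (Y * Yᴴ)).trace := by
          rw [hstar, ← map_mul, specFun_suppPow_conjTranspose, specFun_suppPow_mul hU, hw',
            specFun_suppPow_one hs, hσ]
      _ = ((specFun V' r' (suppPow w))ᴴ * ((specFun U' s' (suppPow (-w)))ᴴ *
            specFun U' s' (suppPow 1) * specFun U' s' (suppPow (-w))) *
            specFun V' r' (suppPow w)).trace := by
          rw [← specFun_suppPow_one hs', ← Matrix.mul_assoc, trace_mul_comm, hY,
            conjTranspose_mul]
          simp only [Matrix.mul_assoc]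
      _ = (specFun V' r' (fun x => x)).trace := by
          have h0 : star (-w) + 1 + -w = 0 := by
            rw [star_neg]
            linear_combination -hw
          rw [specFun_suppPow_conjTranspose, specFun_suppPow_conjTranspose,
            specFun_suppPow_mul hU', specFun_suppPow_mul hU', h0, Matrix.mul_assoc,
            suppPow_zero_mul_of_support hV' hr' hsup', specFun_suppPow_mul hV', hw',
            specFun_suppPow_one hr']
  have hZPZ : (Z * P * (Z * P)ᴴ).trace = (specFun V' r' (fun x => x)).trace := by
    have h1 := hρ 1
    rw [map_one, Matrix.mul_one, Matrix.mul_one] at h1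
    rw [hZP, specFun_suppPow_conjTranspose, specFun_suppPow_mul hV, hw, specFun_suppPow_one hr, h1]
  have hz : Z * (1 - P) = 0 := by
    rw [← trace_mul_conjTranspose_self_eq_zero_iff]
    have h1 : Z * (1 - P) * (Z * (1 - P))ᴴ = Z * Zᴴ - Z * P * (Z * P)ᴴ := by
      simp only [conjTranspose_mul, conjTranspose_sub, conjTranspose_one, hPH]
      calc _ = Z * ((1 - P) * (1 - P)) * Zᴴ := by simp only [Matrix.mul_assoc]
        _ = Z * (1 - P * P) * Zᴴ := by
          congr 2
          simp only [Matrix.mul_sub, Matrix.sub_mul, Matrix.one_mul, Matrix.mul_one, hPP]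
          simp
        _ = _ := by
          simp only [Matrix.mul_sub, Matrix.sub_mul, Matrix.mul_one, Matrix.mul_assoc]
    rw [h1, trace_sub, hZZ, hZPZ, sub_self]
  rw [Matrix.mul_sub, Matrix.mul_one, hZP, sub_eq_zero] at hz
  exact hz

theorem differentiable_specFun_suppPow (U : Matrix n n ℂ) (s : n → ℝ) (a b : n) :
    Differentiable ℂ (fun z => specFun U s (suppPow z) a b) := by
  have : (fun z => specFun U s (suppPow z) a b) =
      fun z => ∑ i, U a i * suppPow z (s i) * Uᴴ i b := by
    ext z
    rw [specFun, Matrix.mul_apply]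
    simp only [mul_diagonal]
  rw [this]
  exact Differentiable.fun_sum fun i _ =>
    ((differentiable_suppPow (s i)).const_mul _).mul_const _

theorem differentiable_mul_apply {l : Type*} [Fintype l] {F G : ℂ → Matrix l l ℂ}
    (hF : ∀ a b, Differentiable ℂ (fun z => F z a b))
    (hG : ∀ a b, Differentiable ℂ (fun z => G z a b)) (a b : l) :
    Differentiable ℂ (fun z => (F z * G z) a b) := by
  simp only [Matrix.mul_apply]
  exact Differentiable.fun_sum fun i _ => (hF a i).mul (hG i b)

theorem differentiable_starAlgHom_apply (e : Matrix m m ℂ →⋆ₐ[ℂ] Matrix n n ℂ)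
    {F : ℂ → Matrix m m ℂ} (hF : ∀ a b, Differentiable ℂ (fun z => F z a b)) (a b : n) :
    Differentiable ℂ (fun z => e (F z) a b) := by
  have : (fun z => e (F z) a b) = fun z => ∑ i, ∑ j, F z i j * e (single i j 1) a b := by
    ext z
    conv_lhs => rw [matrix_eq_sum_single (F z)]
    simp only [map_sum, Matrix.sum_apply]
    refine Finset.sum_congr rfl fun i _ => Finset.sum_congr rfl fun j _ => ?_
    have h : single i j (F z i j) = F z i j • single i j (1 : ℂ) := by
      rw [smul_single, smul_eq_mul, mul_one]
    rw [h, map_smul, Matrix.smul_apply, smul_eq_mul]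
  rw [this]
  exact Differentiable.fun_sum fun i _ => Differentiable.fun_sum fun j _ =>
    (hF i j).mul_const _

theorem eq_of_eq_on_critical_line {f g : ℂ → ℂ} (hf : Differentiable ℂ f)
    (hg : Differentiable ℂ g) (h : ∀ w : ℂ, w + star w = 1 → f w = g w) : f = g := by
  refine AnalyticOnNhd.eq_of_frequently_eq (z₀ := 1 / 2) (fun z _ => hf.analyticAt z)
    (fun z _ => hg.analyticAt z) ?_
  have hc : Filter.Tendsto (fun t : ℝ => (1 / 2 : ℂ) + t * Complex.I)
      (nhdsWithin 0 {0}ᶜ) (nhdsWithin (1 / 2) {1 / 2}ᶜ) := by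
    refine tendsto_nhdsWithin_iff.2 ⟨?_, ?_⟩
    · refine Filter.Tendsto.mono_left ?_ nhdsWithin_le_nhds
      have : Continuous (fun t : ℝ => (1 / 2 : ℂ) + t * Complex.I) := by fun_prop
      simpa using this.tendsto 0
    · filter_upwards [self_mem_nhdsWithin] with t ht
      simpa using ht
  refine hc.frequently (Filter.Eventually.frequently (Filter.Eventually.of_forall fun t => ?_))
  refine h _ (Complex.ext ?_ ?_)
  · simp
    norm_num
  · simp

/-- If relative entropy is preserved under restriction to the subalgebra `e (Matrix m m ℂ)`, then
the support projection of `ρ` factors. -/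
theorem support_factor (e : Matrix m m ℂ →⋆ₐ[ℂ] Matrix n n ℂ)
    {U V : Matrix n n ℂ} {s r : n → ℝ} {U' V' : Matrix m m ℂ} {s' r' : m → ℝ}
    (hU : Uᴴ * U = 1) (hV : Vᴴ * V = 1) (hU' : U'ᴴ * U' = 1) (hV' : V'ᴴ * V' = 1)
    (hs : ∀ i, 0 ≤ s i) (hr : ∀ i, 0 ≤ r i) (hs' : ∀ i, 0 ≤ s' i) (hr' : ∀ i, 0 ≤ r' i)
    (hρ : ∀ Y, (specFun V r (fun x => x) * e Y).trace = (specFun V' r' (fun x => x) * Y).trace)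
    (hσ : ∀ Y, (specFun U s (fun x => x) * e Y).trace = (specFun U' s' (fun x => x) * Y).trace)
    (hsup : specFun U s nzInd * specFun V r (fun x => x) = specFun V r (fun x => x))
    (hsup' : specFun U' s' nzInd * specFun V' r' (fun x => x) = specFun V' r' (fun x => x))
    (hent : ∑ j, r j * Real.log (r j) -
        (specFun V r (fun x => x) * specFun U s (fun x => Real.log x)).trace =
      ∑ j, r' j * Real.log (r' j) -
        (specFun V' r' (fun x => x) * specFun U' s' (fun x => Real.log x)).trace) :
    specFun V r nzInd = e (specFun V' r' nzInd) * specFun U s nzInd := by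
  have h1 := suppPow_intertwine e hU hV hU' hV' hs hr hs' hr' (fun t ht =>
    doubleSpecFun_sylvKer_eq e hU hV hU' hV' hs hr hs' hr' hρ hσ hsup hsup' hent ht)
  have h2 := fun w => suppPow_factor e hU hV hU' hV' hs hr hs' hr' hρ hσ hsup hsup' h1 (w := w)
  have h3 : specFun U s nzInd * e (specFun V' r' nzInd) = specFun V r nzInd := by
    ext a b
    have h4 := congrFun (eq_of_eq_on_critical_line
      (differentiable_mul_apply (differentiable_specFun_suppPow U s)
        (differentiable_starAlgHom_apply e (differentiable_mul_apply
          (fun a b => (differentiable_specFun_suppPow U' s' a b).comp differentiable_neg)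
          (differentiable_specFun_suppPow V' r'))) a b)
      (differentiable_specFun_suppPow V r a b)
      (fun w hw => congrFun (congrFun (h2 w hw) a) b)) 0
    simp only [neg_zero, suppPow_zero_mul_of_support hV' hr' hsup', Function.comp] at h4
    simpa only [suppPow_zero] using h4
  have h4 := congrArg conjTranspose h3
  rw [conjTranspose_mul, specFun_nzInd_conjTranspose, specFun_nzInd_conjTranspose] at h4
  rw [← h4]
  congr 1
  rw [← star_eq_conjTranspose, ← map_star, star_eq_conjTranspose, specFun_nzInd_conjTranspose]

end Conclusion

section Concrete

variable {n : Type*} [Fintype n] [DecidableEq n]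

theorem exists_eq_specFun {M : Matrix n n ℂ} (hM : M.PosSemidef) :
    ∃ (U : Matrix n n ℂ) (s : n → ℝ), Uᴴ * U = 1 ∧ (∀ i, 0 ≤ s i) ∧
      M = specFun U s (fun x => x) ∧ vNEntropy M = -∑ i, s i * Real.log (s i) := by
  refine ⟨hM.isHermitian.eigenvectorUnitary, hM.isHermitian.eigenvalues, ?_,
    hM.eigenvalues_nonneg, ?_, dif_pos hM.isHermitian⟩
  · exact Unitary.coe_star_mul_self _
  · conv_lhs => rw [hM.isHermitian.spectral_theorem]
    rfl

theorem specFun_nzInd_mul_id {U : Matrix n n ℂ} {s : n → ℝ} (hU : Uᴴ * U = 1) :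
    specFun U s nzInd * specFun U s (fun x => x) = specFun U s (fun x => x) := by
  rw [specFun_mul_specFun hU]
  refine specFun_congr fun i => ?_
  by_cases hi : s i = 0 <;> simp [nzInd, hi]

theorem mul_eq_zero_of_mulVec_eq_zero {M P X : Matrix n n ℂ}
    (h : ∀ v, M *ᵥ v = 0 → P *ᵥ v = 0) (hX : M * X = 0) : P * X = 0 := by
  refine ext_of_mulVec_single fun i => ?_
  rw [← mulVec_mulVec, zero_mulVec]
  exact h _ (by rw [mulVec_mulVec, hX, zero_mulVec])

theorem IsSupportProj.eq_specFun {U P : Matrix n n ℂ} {s : n → ℝ} (hU : Uᴴ * U = 1)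
    (h : IsSupportProj (specFun U s (fun x => x)) P) : P = specFun U s nzInd := by
  obtain ⟨hPH, hPP, hker⟩ := h
  have hQH := specFun_nzInd_conjTranspose (U := U) (s := s)
  have h1 : specFun U s (fun x => x) * (1 - P) = 0 :=
    mul_eq_zero_of_mulVec_eq_zero (fun v hv => (hker v).2 hv)
      (by rw [Matrix.mul_sub, Matrix.mul_one, hPP, sub_self])
  have h2 : specFun U s nzInd * (1 - P) = 0 := by
    have h3 : specFun U s nzInd = specFun U s (fun x => (x : ℂ)⁻¹) * specFun U s (fun x => x) := by
      rw [← specFun_id_mul_inv hU, specFun_mul_specFun hU, specFun_mul_specFun hU]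
      simp only [mul_comm]
    rw [h3, Matrix.mul_assoc, h1, Matrix.mul_zero]
  have h4 : P * (1 - specFun U s nzInd) = 0 := by
    refine mul_eq_zero_of_mulVec_eq_zero (fun v hv => (hker v).1 hv) ?_
    have h5 := congrArg conjTranspose (specFun_nzInd_mul_id (s := s) hU)
    rw [conjTranspose_mul, hQH, specFun_id_conjTranspose] at h5
    rw [Matrix.mul_sub, Matrix.mul_one, h5, sub_self]
  rw [Matrix.mul_sub, Matrix.mul_one, sub_eq_zero] at h2 h4
  have h6 := congrArg conjTranspose h4
  rw [conjTranspose_mul, hQH, hPH.eq] at h6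
  rw [h6, ← h2]

theorem support_mul_of_trace_eq {U V : Matrix n n ℂ} {s r : n → ℝ} (hU : Uᴴ * U = 1)
    (hV : Vᴴ * V = 1) (hr : ∀ i, 0 ≤ r i)
    (h : (specFun V r (fun x => x) * specFun U s nzInd).trace =
      (specFun V r (fun x => x)).trace) :
    specFun U s nzInd * specFun V r (fun x => x) = specFun V r (fun x => x) := by
  have hPP : specFun U s nzInd * specFun U s nzInd = specFun U s nzInd := by
    rw [← suppPow_zero, specFun_suppPow_mul hU, add_zero]
  have hD : (1 - specFun U s nzInd)ᴴ * (1 - specFun U s nzInd) = 1 - specFun U s nzInd := by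
    rw [conjTranspose_sub, specFun_nzInd_conjTranspose, conjTranspose_one, Matrix.mul_sub,
      Matrix.mul_one, Matrix.sub_mul, Matrix.one_mul, hPP, sub_self, sub_zero]
  have h1 : ((1 - specFun U s nzInd) * specFun V r (fun x => x) *
      (1 - specFun U s nzInd)ᴴ).trace = 0 := by
    rw [trace_mul_comm, ← Matrix.mul_assoc, hD, trace_mul_comm, Matrix.mul_sub, trace_sub, h,
      Matrix.mul_one, sub_self]
  have h2 := congrArg (· * specFun V r (fun x => x)) (mul_specFun_eq_zero hV hr h1)
  simp only [Matrix.zero_mul] at h2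
  rw [Matrix.mul_assoc, specFun_nzInd_mul_id hV, Matrix.sub_mul, Matrix.one_mul,
    sub_eq_zero] at h2
  exact h2.symm

theorem trace_specFun_mul_log {U : Matrix n n ℂ} {s : n → ℝ} (hU : Uᴴ * U = 1) :
    (specFun U s (fun x => x) * specFun U s (fun x => Real.log x)).trace =
      ((∑ i, s i * Real.log (s i) : ℝ) : ℂ) := by
  rw [specFun_mul_specFun hU, trace_specFun hU]
  push_cast
  rfl

theorem posSemidef_margAB {A B C : Type*} [Fintype C]
    {ρ : Matrix (A × B × C) (A × B × C) ℂ} (hρ : ρ.PosSemidef) :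
    (margAB ρ).PosSemidef := by
  have h : margAB ρ = ∑ c : C, ρ.submatrix
      (fun p : A × B => (p.1, p.2, c)) (fun p => (p.1, p.2, c)) := by
    ext p q
    simp [margAB, Matrix.sum_apply]
  rw [h]
  exact posSemidef_sum _ fun c _ => hρ.submatrix _

theorem posSemidef_margBC {A B C : Type*} [Fintype A]
    {ρ : Matrix (A × B × C) (A × B × C) ℂ} (hρ : ρ.PosSemidef) :
    (margBC ρ).PosSemidef := by
  have h : margBC ρ = ∑ a : A, ρ.submatrix (fun p : B × C => (a, p)) (fun p => (a, p)) := by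
    ext p q
    simp [margBC, Matrix.sum_apply]
  rw [h]
  exact posSemidef_sum _ fun c _ => hρ.submatrix _

theorem posSemidef_margB {A B C : Type*} [Fintype A] [Fintype C]
    {ρ : Matrix (A × B × C) (A × B × C) ℂ} (hρ : ρ.PosSemidef) :
    (margB ρ).PosSemidef := by
  have h : margB ρ = ∑ a : A, (margAB ρ).submatrix (fun b : B => (a, b)) (fun b => (a, b)) := by
    ext p q
    simp [margB, margAB, Matrix.sum_apply]
  rw [h]
  exact posSemidef_sum _ fun c _ => (posSemidef_margAB hρ).submatrix _

theorem trace_mul_one_kronecker {A K : Type*} [Fintype A] [DecidableEq A] [Fintype K]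
    {M : Matrix (A × K) (A × K) ℂ} {N : Matrix K K ℂ}
    (h : ∀ p q, N p q = ∑ a, M (a, p) (a, q)) (L : Matrix K K ℂ) :
    (M * ((1 : Matrix A A ℂ) ⊗ₖ L)).trace = (N * L).trace := by
  simp only [trace, diag, Matrix.mul_apply, Fintype.sum_prod_type, kroneckerMap_apply, one_apply,
    ite_mul, one_mul, zero_mul, mul_ite, mul_zero, h, Finset.sum_mul]
  rw [Finset.sum_comm]
  refine Finset.sum_congr rfl fun p _ => ?_
  conv_rhs => rw [Finset.sum_comm]
  refine Finset.sum_congr rfl fun a _ => ?_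
  rw [Finset.sum_comm]
  simp

variable {A B C K : Type*} [Fintype A] [DecidableEq A] [Fintype B] [DecidableEq B]
    [Fintype C] [DecidableEq C] [Fintype K] [DecidableEq K]

theorem one_kronecker_unitary {U : Matrix K K ℂ} (hU : Uᴴ * U = 1) :
    ((1 : Matrix A A ℂ) ⊗ₖ U)ᴴ * ((1 : Matrix A A ℂ) ⊗ₖ U) = 1 := by
  rw [conjTranspose_kronecker, conjTranspose_one, ← mul_kronecker_mul, hU, Matrix.one_mul,
    one_kronecker_one]

theorem specFun_one_kronecker (U : Matrix K K ℂ) (s : K → ℝ) (f : ℝ → ℂ) :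
    specFun ((1 : Matrix A A ℂ) ⊗ₖ U) (fun p => s p.2) f =
      (1 : Matrix A A ℂ) ⊗ₖ specFun U s f := by
  have h : diagonal (fun p : A × K => f (s p.2)) =
      (1 : Matrix A A ℂ) ⊗ₖ diagonal (fun k => f (s k)) := by
    rw [← diagonal_one, diagonal_kronecker_diagonal]
    simp only [one_mul]
  rw [specFun, specFun, h, conjTranspose_kronecker, conjTranspose_one, ← mul_kronecker_mul,
    ← mul_kronecker_mul, Matrix.one_mul, Matrix.one_mul]

/-- The inclusion `Y ↦ Y ⊗ 1` of the observables on `A × B` into those on `A × B × C`. -/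
noncomputable def ampliation (A B C : Type*) [Fintype A] [DecidableEq A] [Fintype B]
    [DecidableEq B] [Fintype C] [DecidableEq C] :
    Matrix (A × B) (A × B) ℂ →⋆ₐ[ℂ] Matrix (A × B × C) (A × B × C) ℂ where
  toFun Y := Matrix.reindex (Equiv.prodAssoc A B C) (Equiv.prodAssoc A B C)
    (Y ⊗ₖ (1 : Matrix C C ℂ))
  map_one' := by simp
  map_mul' X Y := by
    simp only [reindex_apply]
    rw [submatrix_mul_equiv, ← mul_kronecker_mul, Matrix.one_mul]
  map_zero' := by simp
  map_add' X Y := by simp only [add_kronecker, reindex_apply, submatrix_add, Pi.add_apply]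
  commutes' c := by
    simp only [Algebra.algebraMap_eq_smul_one, smul_kronecker, one_kronecker_one, reindex_apply,
      submatrix_smul, Pi.smul_apply, submatrix_one_equiv]
  map_star' Y := by
    simp only [star_eq_conjTranspose, reindex_apply, conjTranspose_submatrix,
      conjTranspose_kronecker, conjTranspose_one]

theorem ampliation_apply (Y : Matrix (A × B) (A × B) ℂ) (a a' : A) (b b' : B) (c c' : C) :
    ampliation A B C Y (a, b, c) (a', b', c') = Y (a, b) (a', b') * (1 : Matrix C C ℂ) c c' :=
  rfl

theorem trace_mul_ampliation {M : Matrix (A × B × C) (A × B × C) ℂ}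
    {N : Matrix (A × B) (A × B) ℂ}
    (h : ∀ a b a' b', N (a, b) (a', b') = ∑ c, M (a, b, c) (a', b', c))
    (Y : Matrix (A × B) (A × B) ℂ) : (M * ampliation A B C Y).trace = (N * Y).trace := by
  simp only [trace, diag, Matrix.mul_apply, Fintype.sum_prod_type, ampliation_apply, one_apply,
    mul_ite, mul_one, mul_zero, h, Finset.sum_mul, Finset.sum_ite_eq', Finset.mem_univ, if_true]
  refine Finset.sum_congr rfl fun a _ => Finset.sum_congr rfl fun b _ => ?_
  rw [Finset.sum_comm]
  refine Finset.sum_congr rfl fun a' _ => ?_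
  rw [Finset.sum_comm]

theorem trace_one_kronecker_margBC_mul_ampliation (ρ : Matrix (A × B × C) (A × B × C) ℂ)
    (Y : Matrix (A × B) (A × B) ℂ) :
    (((1 : Matrix A A ℂ) ⊗ₖ margBC ρ) * ampliation A B C Y).trace =
      (((1 : Matrix A A ℂ) ⊗ₖ margB ρ) * Y).trace := by
  refine trace_mul_ampliation (fun a b a' b' => ?_) Y
  simp only [kroneckerMap_apply, margB, margBC, of_apply, Finset.mul_sum]
  exact Finset.sum_comm

end Concrete

/-- For a quantum Markov chain `ρ_ABC` (`I(A:C|B) = 0`),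
`P_ABC = (P_AB ⊗ 1_C)(1_A ⊗ P_BC)`. -/
theorem support_proj_eq_product_of_marginal_projs
    {A B C : Type*} [Fintype A] [DecidableEq A] [Fintype B] [DecidableEq B]
    [Fintype C] [DecidableEq C]
    (ρ : Matrix (A × B × C) (A × B × C) ℂ) (hρ : IsDensityMatrix ρ)
    (hMarkov : CMI ρ = 0)
    (PAB : Matrix (A × B) (A × B) ℂ) (hPAB : IsSupportProj (margAB ρ) PAB)
    (PBC : Matrix (B × C) (B × C) ℂ) (hPBC : IsSupportProj (margBC ρ) PBC)
    (PABC : Matrix (A × B × C) (A × B × C) ℂ) (hPABC : IsSupportProj ρ PABC) :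
    PABC = (Matrix.reindex (Equiv.prodAssoc A B C) (Equiv.prodAssoc A B C)
        (PAB ⊗ₖ (1 : Matrix C C ℂ))) * ((1 : Matrix A A ℂ) ⊗ₖ PBC) := by
  obtain ⟨V, r, hV, hr, hVr, hSABC⟩ := exists_eq_specFun hρ.1
  obtain ⟨V', r', hV', hr', hVr', hSAB⟩ := exists_eq_specFun (posSemidef_margAB hρ.1)
  obtain ⟨U, s, hU, hs, hUs, hSBC⟩ := exists_eq_specFun (posSemidef_margBC hρ.1)
  obtain ⟨U', s', hU', hs', hUs', hSB⟩ := exists_eq_specFun (posSemidef_margB hρ.1)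
  have hBC := trace_mul_one_kronecker (M := ρ) (N := margBC ρ) fun _ _ => rfl
  have hB := trace_mul_one_kronecker (M := margAB ρ) (N := margB ρ) fun _ _ => rfl
  have hAB := trace_mul_ampliation (M := ρ) (N := margAB ρ) fun _ _ _ _ => rfl
  have hσ := trace_one_kronecker_margBC_mul_ampliation ρ
  have hBC1 := hBC 1
  have hB1 := hB 1
  rw [one_kronecker_one, Matrix.mul_one, Matrix.mul_one] at hBC1 hB1
  rw [CMI, hSABC, hSAB, hSBC, hSB] at hMarkov
  rw [hVr] at hPABC
  rw [hVr'] at hPAB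
  rw [hUs] at hPBC
  rw [hPABC.eq_specFun hV, hPAB.eq_specFun hV', hPBC.eq_specFun hU, ← specFun_one_kronecker]
  rw [hUs, hUs'] at hσ
  rw [hVr', hUs'] at hB hB1
  have hsup : (ρ * specFun ((1 : Matrix A A ℂ) ⊗ₖ U) (fun p => s p.2) nzInd).trace = ρ.trace := by
    have h := congrArg conjTranspose (specFun_nzInd_mul_id (s := s) hU)
    rw [conjTranspose_mul, specFun_nzInd_conjTranspose, specFun_id_conjTranspose] at h
    rw [specFun_one_kronecker, hBC, hUs, h, ← hUs, hBC1]
  have hsup' : (specFun V' r' (fun x => x) *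
      specFun ((1 : Matrix A A ℂ) ⊗ₖ U') (fun p => s' p.2) nzInd).trace =
      (specFun V' r' (fun x => x)).trace := by
    have h := congrArg conjTranspose (specFun_nzInd_mul_id (s := s') hU')
    rw [conjTranspose_mul, specFun_nzInd_conjTranspose, specFun_id_conjTranspose] at h
    rw [specFun_one_kronecker, hB, h, hB1]
  have hlog := hBC (specFun U s (fun x => Real.log x))
  have hlog' := hB (specFun U' s' (fun x => Real.log x))
  rw [hUs, trace_specFun_mul_log hU, hVr] at hlog
  rw [trace_specFun_mul_log hU'] at hlog'
  rw [hVr] at hsup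
  rw [hVr', hVr] at hAB
  refine support_factor (ampliation A B C) (one_kronecker_unitary hU) hV
    (one_kronecker_unitary hU') hV' (fun p => hs p.2) hr (fun p => hs' p.2) hr' hAB ?_
    (support_mul_of_trace_eq (one_kronecker_unitary hU) hV hr hsup)
    (support_mul_of_trace_eq (one_kronecker_unitary hU') hV' hr' hsup') ?_
  · simpa only [specFun_one_kronecker] using hσ
  · rw [specFun_one_kronecker, specFun_one_kronecker, hlog, hlog', ← Complex.ofReal_sub,
      ← Complex.ofReal_sub]
    congr 1
    linarith
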